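/- Let G be a finite group, σ an automorphism of G with σ² = id, and let H be a finite group containing G as a subgroup of index 2 together with an element τ ∈ H \ G and an element z in the center of G such that τ² = z and τ⁻¹gτ = σ(g) for all g ∈ G. Suppose that every irreducible character of H is real-valued, and that every irreducible character χ of G satisfies ε_σ(χ) = ω_χ(z). Then every real-valued irreducible character χ of G satisfies ε(χ) = 1, and every irreducible character ψ of H satisfies ε(ψ) = 1. -/

import Mathlib

open Matrix CategoryTheory
open scoped Classical

noncomputable section

/-- The Frobenius–Schur indicator of a complex-valued function on a finite group. -/
def fsIndicator (G : Type*) [Group G] [Fintype G] (χ : G → ℂ) : ℂ :=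
  (Fintype.card G : ℂ)⁻¹ * ∑ g : G, χ (g * g)

/-- The twisted Frobenius–Schur indicator of a complex-valued function on a finite group,
with respect to a map `σ`. -/
def twistedFSIndicator (G : Type*) [Group G] [Fintype G] (σ : G → G) (χ : G → ℂ) : ℂ :=
  (Fintype.card G : ℂ)⁻¹ * ∑ g : G, χ (g * σ g)

/-- A complex-valued function is real-valued if all its values are real. -/
def IsRealValued {G : Type*} (χ : G → ℂ) : Prop := ∀ g : G, ∃ r : ℝ, χ g = (r : ℂ)

/-- The Gaussian binomial coefficient `binom(m,k)_q` as a real number. -/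
def gbinom (m k : ℕ) (q : ℝ) : ℝ := ∏ i ∈ Finset.Icc 1 k, (q ^ (m - k + i) - 1) / (q ^ i - 1)

section Groups

variable {N F : Type*} [Fintype N] [DecidableEq N] [Field F]

theorem sim_one (J : Matrix N N F) :
    ((1 : GL N F) : Matrix N N F)ᵀ * J * ((1 : GL N F) : Matrix N N F) = ((1 : Fˣ) : F) • J := by
  simp

theorem sim_mul {J : Matrix N N F} (a b : GL N F) (c d : Fˣ)
    (hc : (a : Matrix N N F)ᵀ * J * (a : Matrix N N F) = (c : F) • J)
    (hd : (b : Matrix N N F)ᵀ * J * (b : Matrix N N F) = (d : F) • J) :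
    ((a * b : GL N F) : Matrix N N F)ᵀ * J * ((a * b : GL N F) : Matrix N N F)
      = ((c * d : Fˣ) : F) • J := by
  calc ((a * b : GL N F) : Matrix N N F)ᵀ * J * ((a * b : GL N F) : Matrix N N F)
      = (b : Matrix N N F)ᵀ * ((a : Matrix N N F)ᵀ * J * (a : Matrix N N F)) *
          (b : Matrix N N F) := by
        rw [show ((a * b : GL N F) : Matrix N N F) = (a : Matrix N N F) * b from rfl,
          transpose_mul]
        simp only [Matrix.mul_assoc]
    _ = (b : Matrix N N F)ᵀ * ((c : F) • J) * (b : Matrix N N F) := by rw [hc]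
    _ = (c : F) • ((b : Matrix N N F)ᵀ * J * (b : Matrix N N F)) := by
        rw [Matrix.mul_smul, Matrix.smul_mul]
    _ = (c : F) • ((d : F) • J) := by rw [hd]
    _ = ((c * d : Fˣ) : F) • J := by rw [smul_smul, Units.val_mul]

theorem sim_inv {J : Matrix N N F} (a : GL N F) (c : Fˣ)
    (hc : (a : Matrix N N F)ᵀ * J * (a : Matrix N N F) = (c : F) • J) :
    ((a⁻¹ : GL N F) : Matrix N N F)ᵀ * J * ((a⁻¹ : GL N F) : Matrix N N F)
      = ((c⁻¹ : Fˣ) : F) • J := by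
  have ht : ((a⁻¹ : GL N F) : Matrix N N F)ᵀ * (a : Matrix N N F)ᵀ = 1 := by
    rw [← transpose_mul, a.mul_inv, transpose_one]
  have key : ((a⁻¹ : GL N F) : Matrix N N F)ᵀ * ((a : Matrix N N F)ᵀ * J * (a : Matrix N N F)) *
      ((a⁻¹ : GL N F) : Matrix N N F) = J := by
    calc ((a⁻¹ : GL N F) : Matrix N N F)ᵀ * ((a : Matrix N N F)ᵀ * J * (a : Matrix N N F)) *
        ((a⁻¹ : GL N F) : Matrix N N F)
        = (((a⁻¹ : GL N F) : Matrix N N F)ᵀ * (a : Matrix N N F)ᵀ) * J *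
          ((a : Matrix N N F) * ((a⁻¹ : GL N F) : Matrix N N F)) := by
          simp only [Matrix.mul_assoc]
      _ = J := by rw [ht, a.mul_inv, Matrix.one_mul, Matrix.mul_one]
  have key2 : ((a⁻¹ : GL N F) : Matrix N N F)ᵀ * ((c : F) • J) * ((a⁻¹ : GL N F) : Matrix N N F)
      = (c : F) • (((a⁻¹ : GL N F) : Matrix N N F)ᵀ * J * ((a⁻¹ : GL N F) : Matrix N N F)) := by
    rw [Matrix.mul_smul, Matrix.smul_mul]
  have h3 : (c : F) • (((a⁻¹ : GL N F) : Matrix N N F)ᵀ * J *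
      ((a⁻¹ : GL N F) : Matrix N N F)) = J := by rw [← key2, ← hc, key]
  calc ((a⁻¹ : GL N F) : Matrix N N F)ᵀ * J * ((a⁻¹ : GL N F) : Matrix N N F)
      = ((c⁻¹ : Fˣ) : F) • ((c : F) • (((a⁻¹ : GL N F) : Matrix N N F)ᵀ * J *
          ((a⁻¹ : GL N F) : Matrix N N F))) := by
        rw [smul_smul, ← Units.val_mul, inv_mul_cancel, Units.val_one, one_smul]
    _ = ((c⁻¹ : Fˣ) : F) • J := by rw [h3]

/-- The similitude group of the bilinear form given by the matrix `J`:  all invertible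
matrices `g` with `gᵀ * J * g = c • J` for some nonzero scalar `c` (the similitude of `g`). -/
def similitudeGroup (J : Matrix N N F) : Subgroup (GL N F) where
  carrier := {g | ∃ c : Fˣ, (g : Matrix N N F)ᵀ * J * (g : Matrix N N F) = (c : F) • J}
  one_mem' := ⟨1, sim_one J⟩
  mul_mem' := by rintro a b ⟨c, hc⟩ ⟨d, hd⟩; exact ⟨c * d, sim_mul a b c d hc hd⟩
  inv_mem' := by rintro a ⟨c, hc⟩; exact ⟨c⁻¹, sim_inv a c hc⟩

/-- The isometry group of the bilinear form given by the matrix `J`:  all invertible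
matrices `g` with `gᵀ * J * g = J`. -/
def fixGroup (J : Matrix N N F) : Subgroup (GL N F) where
  carrier := {g | (g : Matrix N N F)ᵀ * J * (g : Matrix N N F) = J}
  one_mem' := by simp
  mul_mem' := by
    intro a b ha hb
    have := sim_mul (J := J) a b 1 1 (by simpa using ha) (by simpa using hb)
    simpa using this
  inv_mem' := by
    intro a ha
    have := sim_inv (J := J) a 1 (by simpa using ha)
    simpa using this

/-- The group of isometries of determinant one of the bilinear form given by the matrix `J`. -/
def specialFixGroup (J : Matrix N N F) : Subgroup (GL N F) where
  carrier := {g | (g : Matrix N N F)ᵀ * J * (g : Matrix N N F) = J ∧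
    ((g : Matrix N N F)).det = 1}
  one_mem' := ⟨by simp, by simp⟩
  mul_mem' := by
    rintro a b ⟨ha1, ha2⟩ ⟨hb1, hb2⟩
    refine ⟨(fixGroup J).mul_mem ha1 hb1, ?_⟩
    rw [show ((a * b : GL N F) : Matrix N N F) = (a : Matrix N N F) * b from rfl,
      Matrix.det_mul, ha2, hb2, one_mul]
  inv_mem' := by
    rintro a ⟨ha1, ha2⟩
    refine ⟨(fixGroup J).inv_mem ha1, ?_⟩
    have h := congrArg Matrix.det a.mul_inv
    rw [Matrix.det_mul, ha2, one_mul, Matrix.det_one] at h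
    exact h

/-- The connected component of the similitude group of the symmetric bilinear form on a
`2 * m`-dimensional space given by the matrix `J`:  all similitudes `g`, with similitude
character `μ`, such that `det g = μ(g) ^ m`. -/
def connSimilitudeGroup (J : Matrix N N F) (m : ℕ) : Subgroup (GL N F) where
  carrier := {g | ∃ c : Fˣ, (g : Matrix N N F)ᵀ * J * (g : Matrix N N F) = (c : F) • J ∧
    ((g : Matrix N N F)).det = (c : F) ^ m}
  one_mem' := ⟨1, sim_one J, by simp⟩
  mul_mem' := by
    rintro a b ⟨c, hc1, hc2⟩ ⟨d, hd1, hd2⟩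
    refine ⟨c * d, sim_mul a b c d hc1 hd1, ?_⟩
    rw [show ((a * b : GL N F) : Matrix N N F) = (a : Matrix N N F) * b from rfl,
      Matrix.det_mul, hc2, hd2, Units.val_mul, mul_pow]
  inv_mem' := by
    rintro a ⟨c, hc1, hc2⟩
    refine ⟨c⁻¹, sim_inv a c hc1, ?_⟩
    have h := congrArg Matrix.det a.mul_inv
    rw [Matrix.det_mul, hc2, Matrix.det_one] at h
    have hc : ((c : F) ^ m)⁻¹ = ((c⁻¹ : Fˣ) : F) ^ m := by
      rw [← inv_pow]
      norm_cast
    rw [← hc]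
    exact (inv_eq_of_mul_eq_one_right h).symm

theorem neg_one_mem_similitudeGroup (J : Matrix N N F) : (-1 : GL N F) ∈ similitudeGroup J := by
  refine ⟨1, ?_⟩
  have h : ((-1 : GL N F) : Matrix N N F) = -1 := by simp
  rw [h]
  simp

/-- The standard symplectic form matrix `[[0, I], [-I, 0]]`. -/
def Jsp (n : ℕ) (F : Type*) [Field F] : Matrix (Fin n ⊕ Fin n) (Fin n ⊕ Fin n) F :=
  Matrix.fromBlocks 0 1 (-1) 0

/-- The standard split symmetric form matrix `[[0, I], [I, 0]]`. -/
def Jsplit (n : ℕ) (F : Type*) [Field F] : Matrix (Fin n ⊕ Fin n) (Fin n ⊕ Fin n) F :=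
  Matrix.fromBlocks 0 1 1 0

/-- A symmetric matrix `J` of size `2n` is split if it is congruent to `[[0, I], [I, 0]]`. -/
def IsSplit {n : ℕ} (J : Matrix (Fin n ⊕ Fin n) (Fin n ⊕ Fin n) F) : Prop :=
  ∃ P : GL (Fin n ⊕ Fin n) F,
    (P : Matrix (Fin n ⊕ Fin n) (Fin n ⊕ Fin n) F)ᵀ * J * P = Jsplit n F

/-- The symplectic similitude group `GSp(2n, F)`. -/
def GSp (n : ℕ) (F : Type*) [Field F] : Subgroup (GL (Fin n ⊕ Fin n) F) :=
  similitudeGroup (Jsp n F)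

/-- The symplectic group `Sp(2n, F)`. -/
def Sp (n : ℕ) (F : Type*) [Field F] : Subgroup (GL (Fin n ⊕ Fin n) F) :=
  fixGroup (Jsp n F)


/-- The underlying matrix of an element of a matrix subgroup. -/
def matOf {S : Subgroup (GL N F)} (g : ↥S) : Matrix N N F := ((g : GL N F) : Matrix N N F)

end Groups

noncomputable instance subgroupFintype {G : Type*} [Group G] [Finite G] (S : Subgroup G) :
    Fintype S := Fintype.ofFinite _

open Representation in
theorem simple_of_isIrreducible {K : Type} [Group K] [Fintype K] {V : Type} [AddCommGroup V]
    [Module ℂ V] [FiniteDimensional ℂ V] (ρ : Representation ℂ K V) [IsIrreducible ρ] :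
    Simple (FDRep.of ρ) := by
  have : Invertible (Nat.card K : ℂ) := invertibleOfNonzero (NeZero.ne _)
  rw [FDRep.simple_iff_char_is_norm_one]
  have h := char_orthonormal ρ ρ
  rw [if_pos ⟨Representation.Equiv.refl ρ⟩, inv_mul_eq_one₀ (NeZero.ne _)] at h
  exact h.symm

/-- Every nonzero character is a sum of irreducible characters. -/
theorem character_induction {K : Type} [Group K] [Fintype K] (P : (K → ℂ) → Prop)
    (hsimple : ∀ ρ : FDRep ℂ K, Simple ρ → P ρ.character)
    (hadd : ∀ f₁ f₂, P f₁ → P f₂ → P (f₁ + f₂)) (n : ℕ) :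
    ∀ {V : Type} [AddCommGroup V] [Module ℂ V] [FiniteDimensional ℂ V] [Nontrivial V]
      (ρ : Representation ℂ K V), Module.finrank ℂ V = n → P ρ.character := by
  induction n using Nat.strong_induction_on with
  | _ n ih =>
  intro V _ _ _ _ ρ hn
  by_cases hirr : Representation.IsIrreducible ρ
  · exact hsimple (FDRep.of ρ) (simple_of_isIrreducible ρ)
  · have hbt : (⊥ : Subrepresentation ρ) ≠ ⊤ := fun h =>
      bot_ne_top (α := Submodule ℂ V) (congrArg Subrepresentation.toSubmodule h)
    obtain ⟨W, hW0, hW1⟩ : ∃ W : Subrepresentation ρ, W ≠ ⊥ ∧ W ≠ ⊤ := by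
      by_contra! hcon
      have : Nontrivial (Subrepresentation ρ) := ⟨_, _, hbt⟩
      exact hirr ⟨fun W => or_iff_not_imp_left.2 (hcon W)⟩
    obtain ⟨W', hWW'⟩ := exists_isCompl W
    have hinf : W.toSubmodule ⊓ W'.toSubmodule = ⊥ :=
      congrArg Subrepresentation.toSubmodule hWW'.inf_eq_bot
    have hsup : W.toSubmodule ⊔ W'.toSubmodule = ⊤ :=
      congrArg Subrepresentation.toSubmodule hWW'.sup_eq_top
    have hc : IsCompl W.toSubmodule W'.toSubmodule :=
      ⟨disjoint_iff.2 hinf, codisjoint_iff.2 hsup⟩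
    have hW0' : W.toSubmodule ≠ ⊥ := fun h => hW0 (Subrepresentation.toSubmodule_injective h)
    have hW1' : W.toSubmodule ≠ ⊤ := fun h => hW1 (Subrepresentation.toSubmodule_injective h)
    have hW0'' : W'.toSubmodule ≠ ⊥ := fun h => hW1' (by simpa [h] using hsup)
    have hW1'' : W'.toSubmodule ≠ ⊤ := fun h => hW0' (by simpa [h] using hinf)
    have := Submodule.nontrivial_iff_ne_bot.2 hW0'
    have := Submodule.nontrivial_iff_ne_bot.2 hW0''
    have h1 := ih _ (hn ▸ Submodule.finrank_lt hW1') W.toRepresentation rfl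
    have h2 := ih _ (hn ▸ Submodule.finrank_lt hW1'') W'.toRepresentation rfl
    convert hadd _ _ h1 h2 using 1
    ext g
    have hconj : ρ g = (Submodule.prodEquivOfIsCompl _ _ hc).conj
        ((W.toRepresentation g).prodMap (W'.toRepresentation g)) := by
      ext1 v
      obtain ⟨x, rfl⟩ := (Submodule.prodEquivOfIsCompl _ _ hc).surjective v
      simp [LinearEquiv.conj_apply, Subrepresentation.toRepresentation]
    rw [Representation.character, hconj, LinearMap.trace_conj', LinearMap.trace_prodMap']
    rfl

open scoped TensorProduct in
theorem trace_comm_comp_map {V : Type*} [AddCommGroup V] [Module ℂ V] [FiniteDimensional ℂ V]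
    (A B : V →ₗ[ℂ] V) :
    LinearMap.trace ℂ (V ⊗[ℂ] V)
      ((TensorProduct.comm ℂ V V).toLinearMap ∘ₗ TensorProduct.map A B) =
      LinearMap.trace ℂ V (A * B) := by
  let b := Module.finBasis ℂ V
  rw [LinearMap.trace_eq_matrix_trace ℂ (b.tensorProduct b), LinearMap.trace_eq_matrix_trace ℂ b,
    LinearMap.toMatrix_mul]
  simp only [Matrix.trace, Matrix.diag, Matrix.mul_apply, Fintype.sum_prod_type,
    LinearMap.toMatrix_apply]
  simp [Module.Basis.tensorProduct_apply]
  exact Finset.sum_comm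

/-- An involution commuting with an idempotent of rank at most one acts on its image by a sign. -/
theorem trace_involution_mul_idempotent {V : Type*} [AddCommGroup V] [Module ℂ V]
    [FiniteDimensional ℂ V] {S P : Module.End ℂ V} (hS : S * S = 1) (hSP : S * P = P * S)
    {U : Submodule ℂ V} (hP : LinearMap.IsProj U P) (hU : Module.finrank ℂ U = 1) :
    LinearMap.trace ℂ V (S * P) = 1 ∨ LinearMap.trace ℂ V (S * P) = -1 := by
  obtain ⟨⟨u, hu⟩, hu0, hspan⟩ := finrank_eq_one_iff'.1 hU
  have hu0' : u ≠ 0 := fun h => hu0 (by simp [h])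
  have hspan' : ∀ w ∈ U, ∃ c : ℂ, c • u = w := fun w hw => by
    obtain ⟨c, hc⟩ := hspan ⟨w, hw⟩
    exact ⟨c, congrArg Subtype.val hc⟩
  have hSU : ∀ w ∈ U, S w ∈ U := fun w hw => by
    have h := congrArg (fun f => f w) hSP
    simp only [Module.End.mul_apply, hP.map_id w hw] at h
    rw [h]; exact hP.map_mem _
  obtain ⟨c, hc⟩ := hspan' _ (hSU u hu)
  have hc2 : c * c = 1 := by
    have h := congrArg (fun f => f u) hS
    simp only [Module.End.mul_apply, ← hc, map_smul, smul_smul, Module.End.one_apply] at h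
    have : (c * c - 1) • u = 0 := by rw [sub_smul, h, one_smul, sub_self]
    rcases smul_eq_zero.1 this with h | h
    · linear_combination h
    · exact absurd h hu0'
  have hSPc : S * P = c • P := by
    ext v
    obtain ⟨a, ha⟩ := hspan' _ (hP.map_mem v)
    simp only [Module.End.mul_apply, LinearMap.smul_apply, ← ha, map_smul, ← hc]
    rw [smul_comm]
  have htr : LinearMap.trace ℂ V (S * P) = c := by
    rw [hSPc, map_smul, hP.trace, hU]; simp
  rw [htr]
  exact mul_self_eq_one_iff.1 hc2

theorem twistedFSIndicator_trichotomy {K : Type} [Group K] [Fintype K] (V : FDRep ℂ K) [Simple V]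
    (σ : K ≃* K) (hσ : ∀ g, σ (σ g) = g) :
    let e := twistedFSIndicator K (fun g => σ g) V.character
    (e = 1 ∨ e = -1) ∨ (e = 0 ∧ ∑ g, V.character g * V.character (σ g) = 0) := by
  have : Invertible (Nat.card K : ℂ) := invertibleOfNonzero (NeZero.ne _)
  have : Invertible (Fintype.card K : ℂ) := invertibleOfNonzero (NeZero.ne _)
  let ρ : Representation ℂ K V := V.ρ
  let ρσ : Representation ℂ K V := ρ.comp σ.toMonoidHom
  have hV := (FDRep.simple_iff_char_is_norm_one V).1 inferInstance
  have hσchar : ∀ g, (FDRep.of ρσ).character g = V.character (σ g) := fun g => rfl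
  have : Simple (FDRep.of ρσ) := by
    rw [FDRep.simple_iff_char_is_norm_one, ← hV]
    simp only [hσchar, map_inv]
    exact Fintype.sum_equiv σ.toEquiv _ _ fun g => rfl
  have : Simple (FDRep.of ρ.dual) := by
    rw [FDRep.simple_iff_char_is_norm_one, ← hV]
    simp only [ρ, FDRep.char_dual]
    exact Finset.sum_congr rfl fun g _ => by rw [inv_inv, mul_comm]
  let T := Representation.tprod ρ ρσ
  have hT : ∀ g, T.character g = V.character g * V.character (σ g) := fun g => by
    simp only [T, Representation.char_tensor]; rfl
  have hfin : (Module.finrank ℂ T.invariants : ℂ) = 0 ∨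
      (Module.finrank ℂ T.invariants : ℂ) = 1 := by
    rw [← Representation.card_inv_mul_sum_char_eq_finrank]
    have h := FDRep.char_orthonormal (FDRep.of ρσ) (FDRep.of ρ.dual)
    simp only [ρ, FDRep.char_dual, hσchar, inv_inv] at h
    simp only [fun g => (hT g).trans (mul_comm _ _)]
    rw [h]
    split_ifs <;> simp
  let S : Module.End ℂ (TensorProduct ℂ V V) := (TensorProduct.comm ℂ V V).toLinearMap
  have hS : S * S = 1 := by
    ext; simp [S]
  have hPdef : T.averageMap = (Fintype.card K : ℂ)⁻¹ • ∑ g : K, T g := by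
    simp only [Representation.averageMap, GroupAlgebra.average, map_smul, map_sum,
      MonoidAlgebra.of_apply, Representation.asAlgebraHom_single_one, invOf_eq_inv]
  have hSg : ∀ g, S * T g = T (σ g) * S := fun g => by
    ext v w
    simp [S, T, ρσ, hσ]
  have hSP : S * T.averageMap = T.averageMap * S := by
    rw [hPdef, mul_smul_comm, smul_mul_assoc, Finset.mul_sum, Finset.sum_mul]
    congr 1
    exact Fintype.sum_equiv σ.toEquiv _ _ hSg
  have htr : LinearMap.trace ℂ _ (S * T.averageMap) =
      twistedFSIndicator K (fun g => σ g) V.character := by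
    rw [hPdef, mul_smul_comm, Finset.mul_sum, map_smul, map_sum, twistedFSIndicator, smul_eq_mul]
    congr 1
    refine Finset.sum_congr rfl fun g _ => ?_
    refine (trace_comm_comp_map (ρ g) (ρσ g)).trans ?_
    change _ = LinearMap.trace ℂ V (ρ (g * σ g))
    rw [MonoidHom.map_mul]
    rfl
  intro e
  rcases hfin with h | h
  · right
    constructor
    · have h0 : Module.finrank ℂ T.invariants = 0 := by exact_mod_cast h
      have hz : T.averageMap = 0 := by
        refine LinearMap.ext fun v => ?_
        have := T.averageMap_invariant v
        rw [Submodule.finrank_eq_zero.1 h0] at this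
        simpa using this
      change twistedFSIndicator K (fun g => σ g) V.character = 0
      rw [← htr, hz, mul_zero, map_zero]
    · rw [← Representation.card_inv_mul_sum_char_eq_finrank] at h
      simpa [hT] using h
  · left
    change twistedFSIndicator K (fun g => σ g) V.character = 1 ∨
      twistedFSIndicator K (fun g => σ g) V.character = -1
    rw [← htr]
    exact trace_involution_mul_idempotent hS hSP T.isProj_averageMap (by exact_mod_cast h)

theorem fsIndicator_of_isRealValued {K : Type} [Group K] [Fintype K] (V : FDRep ℂ K) [Simple V]
    (hV : IsRealValued V.character) :
    fsIndicator K V.character = 1 ∨ fsIndicator K V.character = -1 := by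
  refine (twistedFSIndicator_trichotomy V (MulEquiv.refl K) fun _ => rfl).resolve_right ?_
  rintro ⟨-, h⟩
  choose r hr using hV
  simp only [MulEquiv.refl_apply, hr] at h
  have h' : ∑ g, r g * r g = 0 := by exact_mod_cast h
  have hzero := (Finset.sum_eq_zero_iff_of_nonneg fun g _ => mul_self_nonneg (r g)).1 h'
  have hall : ∀ g, V.character g = 0 := fun g => by
    rw [hr, mul_self_eq_zero.1 (hzero g (Finset.mem_univ g))]; simp
  have hn := (FDRep.simple_iff_char_is_norm_one V).1 inferInstance
  simp only [hall, mul_zero, Finset.sum_const_zero] at hn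
  exact NeZero.ne (Nat.card K : ℂ) hn.symm

theorem nontrivial_of_simple {K : Type} [Group K] [Fintype K] (V : FDRep ℂ K) [Simple V] :
    Nontrivial V := by
  by_contra h
  have : Subsingleton V := not_nontrivial_iff_subsingleton.1 h
  have hn := (FDRep.simple_iff_char_is_norm_one V).1 inferInstance
  have hall : ∀ g, V.character g = 0 := fun g => by
    rw [FDRep.character, Subsingleton.elim (V.ρ g) 0, map_zero]
  simp only [hall, mul_zero, Finset.sum_const_zero] at hn
  exact NeZero.ne (Nat.card K : ℂ) hn.symm

theorem character_one_ne_zero {K : Type} [Group K] [Fintype K] (V : FDRep ℂ K) [Simple V] :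
    V.character 1 ≠ 0 := by
  have := nontrivial_of_simple V
  rw [FDRep.char_one]
  exact_mod_cast (Module.finrank_pos (R := ℂ) (M := V)).ne'

theorem character_center_mul {K : Type} [Group K] [Fintype K] (V : FDRep ℂ K) [Simple V]
    {z : K} (hz : z ∈ Subgroup.center K) (g : K) :
    V.character (z * g) = V.character z / V.character 1 * V.character g := by
  have : Invertible (Nat.card K : ℂ) := invertibleOfNonzero (NeZero.ne _)
  have := nontrivial_of_simple V
  let ρ : Representation ℂ K V := V.ρ
  have h1 : Module.finrank ℂ (Representation.IntertwiningMap ρ ρ) = 1 := by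
    have h := Representation.card_inv_mul_sum_char_mul_char_eq_finrank ρ ρ
    have h' : (Nat.card K : ℂ)⁻¹ * ∑ g : K, ρ.character g * ρ.character g⁻¹ = 1 := by
      rw [inv_mul_eq_one₀ (NeZero.ne _)]
      exact ((FDRep.simple_iff_char_is_norm_one V).1 inferInstance).symm
    exact_mod_cast h.symm.trans h'
  let one : Representation.IntertwiningMap ρ ρ := ⟨LinearMap.id, fun g => rfl⟩
  have hone : one ≠ 0 := fun h => by
    obtain ⟨v, hv⟩ := exists_ne (0 : V)
    exact hv (congrArg (fun f : Representation.IntertwiningMap ρ ρ => f.toLinearMap v) h)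
  let Z : Representation.IntertwiningMap ρ ρ := ⟨ρ z, fun g => by
    change ρ z * ρ g = ρ g * ρ z
    rw [← map_mul, ← map_mul, Subgroup.mem_center_iff.1 hz g]⟩
  obtain ⟨c, hc⟩ := (finrank_eq_one_iff_of_nonzero' one hone).1 h1 Z
  have hc' : ρ z = c • 1 :=
    (congrArg (fun f : Representation.IntertwiningMap ρ ρ => f.toLinearMap) hc).symm
  have hmul : ∀ h, V.character (z * h) = c * V.character h := fun h => by
    change LinearMap.trace ℂ V (ρ (z * h)) = c * LinearMap.trace ℂ V (ρ h)
    rw [map_mul, hc', smul_mul_assoc, one_mul, map_smul, smul_eq_mul]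
  have hz1 := hmul 1
  rw [mul_one] at hz1
  rw [hmul, hz1, mul_div_cancel_right₀ _ (character_one_ne_zero V)]

section IndexTwo

variable {H : Type} [Group H] {G : Subgroup H} {τ : H}

theorem mul_mem_of_index_two (hindex : G.index = 2) (hτ : τ ∉ G) {h : H} (hh : h ∉ G) :
    h * τ⁻¹ ∈ G := by
  rw [Subgroup.mul_mem_iff_of_index_two hindex, inv_mem_iff]
  exact iff_of_false hh hτ

theorem sum_of_index_two [Fintype H] {M : Type*} [AddCommMonoid M] (hindex : G.index = 2)
    (hτ : τ ∉ G) (f : H → M) : ∑ h, f h = ∑ g : G, f g + ∑ g : G, f (g * τ) := by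
  refine (Function.Bijective.sum_comp (e := fun x : G ⊕ G =>
    Sum.elim (fun g : G => (g : H)) (fun g : G => (g : H) * τ) x) ⟨?_, ?_⟩ f).symm.trans ?_
  · rintro (a | a) (b | b) hab <;> simp only [Sum.elim_inl, Sum.elim_inr] at hab
    · rw [Subtype.ext hab]
    · exact absurd ((G.mul_mem_cancel_left b.2).1 (hab ▸ a.2)) hτ
    · exact absurd ((G.mul_mem_cancel_left a.2).1 (hab ▸ b.2)) hτ
    · rw [Subtype.ext (mul_right_cancel hab)]
  · intro h
    by_cases hh : h ∈ G
    · exact ⟨Sum.inl ⟨h, hh⟩, rfl⟩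
    · exact ⟨Sum.inr ⟨h * τ⁻¹, mul_mem_of_index_two hindex hτ hh⟩, by simp⟩
  · simp only [Fintype.sum_sum_type, Sum.elim_inl, Sum.elim_inr]

/-- A monoid homomorphism on an index two subgroup extends to the whole group once a compatible
image of an element of the nontrivial coset is given. -/
theorem exists_extension_of_index_two {M : Type*} [Monoid M] (hindex : G.index = 2)
    (hτ : τ ∉ G) {σ : G → G} (hσ : ∀ g, σ (σ g) = g) {z : G} (hτsq : τ * τ = z)
    (hconj : ∀ g : G, (g : H) * τ = τ * σ g) (D : G →* M) (T : M) (hT : T * T = D z)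
    (hDT : ∀ g, D g * T = T * D (σ g)) :
    ∃ π : H →* M, (∀ g : G, π g = D g) ∧ ∀ g : G, π (g * τ) = D g * T := by
  let F : H → M := fun h =>
    if hh : h ∈ G then D ⟨h, hh⟩ else D ⟨h * τ⁻¹, mul_mem_of_index_two hindex hτ hh⟩ * T
  have hF : ∀ g : G, F g = D g := fun g => by simp [F]
  have hFτ : ∀ g : G, F (g * τ) = D g * T := fun g => by
    have : (g : H) * τ ∉ G := fun h => hτ ((G.mul_mem_cancel_left g.2).1 h)
    simp [F, this]
  have hcases : ∀ h : H, (∃ g : G, h = g) ∨ ∃ g : G, h = g * τ := fun h => by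
    by_cases hh : h ∈ G
    · exact Or.inl ⟨⟨h, hh⟩, rfl⟩
    · exact Or.inr ⟨⟨h * τ⁻¹, mul_mem_of_index_two hindex hτ hh⟩, by simp⟩
  have hconj' : ∀ g : G, τ * g = σ g * τ := fun g => by rw [hconj, hσ]
  have hDT' : ∀ g : G, T * D g = D (σ g) * T := fun g => by rw [hDT, hσ]
  have hone : F 1 = 1 := by simpa using hF 1
  have hmul : ∀ a b, F (a * b) = F a * F b := by
    intro a b
    rcases hcases a with ⟨a, rfl⟩ | ⟨a, rfl⟩ <;> rcases hcases b with ⟨b, rfl⟩ | ⟨b, rfl⟩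
    · rw [← Subgroup.coe_mul, hF, hF, hF, map_mul]
    · rw [← mul_assoc, ← Subgroup.coe_mul, hFτ, hF, hFτ, map_mul, mul_assoc]
    · rw [mul_assoc, hconj', ← mul_assoc, ← Subgroup.coe_mul, hFτ, hF, hFτ, map_mul, mul_assoc,
        mul_assoc, hDT']
    · have h : (a : H) * τ * (b * τ) = ((a * σ b * z : G) : H) := by
        push_cast
        rw [← hτsq, mul_assoc, ← mul_assoc τ, hconj', mul_assoc, mul_assoc]
      rw [h, hF, hFτ, hFτ, map_mul, map_mul, ← hT, mul_assoc (D a) T, ← mul_assoc T, hDT']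
      simp only [mul_assoc]
  exact ⟨⟨⟨F, hone⟩, hmul⟩, hF, hFτ⟩

end IndexTwo

/-- If `ε_σ(χ) = ω_χ(z)` then the twisted squares `z g σ(g)` have average character value one. -/
theorem sum_character_mul_center {K : Type} [Group K] [Fintype K] (V : FDRep ℂ K) [Simple V]
    (σ : K ≃* K) (hσ : ∀ g, σ (σ g) = g) {z : K} (hz : z ∈ Subgroup.center K)
    (hV : twistedFSIndicator K (fun g => σ g) V.character = V.character z / V.character 1) :
    ∑ g, V.character (z * (g * σ g)) = Fintype.card K := by
  have hcard : (Fintype.card K : ℂ) ≠ 0 := by exact_mod_cast Fintype.card_ne_zero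
  have hω : V.character z / V.character 1 ≠ 0 := fun h => by
    have h1 := character_center_mul V hz z⁻¹
    rw [h, zero_mul, mul_inv_cancel] at h1
    exact character_one_ne_zero V h1
  have hsum : ∑ g, V.character (g * σ g) =
      Fintype.card K * (V.character z / V.character 1) := by
    rw [← hV, twistedFSIndicator, mul_inv_cancel_left₀ hcard]
  simp only [character_center_mul V hz, ← Finset.mul_sum]
  rw [hsum]
  rcases twistedFSIndicator_trichotomy V σ hσ with (h | h) | ⟨h, -⟩
  · rw [← hV, h]; ring
  · rw [← hV, h]; ring
  · exact absurd (hV.symm.trans h) hω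

theorem stmt_0 (H : Type) [Group H] [Fintype H] (G : Subgroup H)
    (hindex : G.index = 2)
    (σ : ↥G ≃* ↥G) (hσ : ∀ g : ↥G, σ (σ g) = g)
    (τ : H) (hτ : τ ∉ G)
    (z : ↥G) (hz : z ∈ Subgroup.center ↥G)
    (hτsq : τ * τ = (z : H))
    (hτconj : ∀ g : ↥G, τ⁻¹ * (g : H) * τ = ((σ g : ↥G) : H))
    (hHreal : ∀ ψ : FDRep ℂ H, Simple ψ → IsRealValued ψ.character)
    (hTFS : ∀ ρ : FDRep ℂ ↥G, Simple ρ →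
      twistedFSIndicator ↥G (fun g => σ g) ρ.character = ρ.character z / ρ.character 1) :
    (∀ ρ : FDRep ℂ ↥G, Simple ρ → IsRealValued ρ.character →
      fsIndicator ↥G ρ.character = 1) ∧
    (∀ ψ : FDRep ℂ H, Simple ψ → fsIndicator H ψ.character = 1) := by
  have hconj : ∀ g : G, (g : H) * τ = τ * σ g := fun g => by
    rw [← hτconj g]; group
  have hσz : σ z = z := Subtype.ext (by rw [← hτconj, ← hτsq]; group)
  have hcardG : (Fintype.card G : ℂ) ≠ 0 := by exact_mod_cast Fintype.card_ne_zero
  have hcardH : (Fintype.card H : ℂ) = 2 * Fintype.card G := by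
    rw [← Nat.card_eq_fintype_card, ← Nat.card_eq_fintype_card, ← G.card_mul_index, hindex]
    push_cast; ring
  have hsq : ∀ g : G, ((g : H) * τ) * (g * τ) = ((z * (g * σ g) : G) : H) := fun g => by
    have hzc := Subgroup.mem_center_iff.1 hz (g * σ g)
    rw [← hzc]
    push_cast
    rw [← hτsq]
    calc ((g : H) * τ) * (g * τ) = g * τ * (τ * σ g) := by rw [hconj]
      _ = g * ((τ * τ) * σ g) := by group
      _ = g * (σ g * (τ * τ)) := by
        rw [hτsq, ← Subgroup.coe_mul, ← Subgroup.mem_center_iff.1 hz (σ g), Subgroup.coe_mul]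
      _ = _ := by group
  have hext : ∀ f : H → ℂ, fsIndicator H f = (2 * Fintype.card G : ℂ)⁻¹ *
      (∑ g : G, f ((g * g : G) : H) + ∑ g : G, f ((z * (g * σ g) : G) : H)) := fun f => by
    rw [fsIndicator, hcardH, sum_of_index_two hindex hτ]
    simp only [hsq]
    rfl
  have hcoset : ∀ ρ : FDRep ℂ G, Simple ρ →
      ∑ g : G, ρ.character (z * (g * σ g)) = Fintype.card G := fun ρ hρ =>
    sum_character_mul_center ρ σ hσ hz (hTFS ρ hρ)
  have hsum : ∀ ρ : FDRep ℂ G, ∑ g : G, ρ.character (g * g) =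
      Fintype.card G * fsIndicator G ρ.character := fun ρ => by
    rw [fsIndicator, mul_inv_cancel_left₀ hcardG]
  have hH : ∀ ψ : FDRep ℂ H, Simple ψ → fsIndicator H ψ.character = 1 := by
    intro ψ hψ
    have := nontrivial_of_simple ψ
    have hres := character_induction (K := G)
      (fun f => 0 ≤ (∑ g : G, f (g * g) + ∑ g : G, f (z * (g * σ g))).re)
      (fun ρ hρ => by
        rw [hcoset ρ hρ, hsum]
        rcases twistedFSIndicator_trichotomy ρ (MulEquiv.refl G) fun _ => rfl with
          (h | h) | ⟨h, -⟩ <;>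
        · change fsIndicator G ρ.character = _ at h
          rw [h]
          norm_num)
      (fun f₁ f₂ h₁ h₂ => by
        simp only [Pi.add_apply, Finset.sum_add_distrib, Complex.add_re] at h₁ h₂ ⊢
        linarith) _ (MonoidHom.comp ψ.ρ G.subtype : Representation ℂ G ψ) rfl
    refine (fsIndicator_of_isRealValued ψ (hHreal ψ hψ)).resolve_right fun hneg => ?_
    rw [hext, inv_mul_eq_iff_eq_mul₀ (mul_ne_zero two_ne_zero hcardG)] at hneg
    have hpos : 0 < Fintype.card G := Fintype.card_pos
    change 0 ≤ (∑ g : G, ψ.character ((g * g : G) : H) +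
      ∑ g : G, ψ.character ((z * (g * σ g) : G) : H)).re at hres
    rw [hneg] at hres
    have hpos' : (0 : ℝ) < Fintype.card G := by exact_mod_cast hpos
    norm_num at hres
    linarith
  refine ⟨fun ρ hρ hreal => (fsIndicator_of_isRealValued ρ hreal).resolve_right fun hneg => ?_, hH⟩
  have := nontrivial_of_simple ρ
  let r : Representation ℂ G ρ := ρ.ρ
  let D : G →* Module.End ℂ (ρ × ρ) :=
    { toFun := fun g => (r g).prodMap (r (σ g))
      map_one' := by ext <;> simp
      map_mul' := fun a b => by ext <;> simp }
  let T : Module.End ℂ (ρ × ρ) :=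
    (r z ∘ₗ LinearMap.snd ℂ ρ ρ).prod (LinearMap.fst ℂ ρ ρ)
  obtain ⟨π, hπ, -⟩ := exists_extension_of_index_two hindex hτ hσ hτsq hconj D T
    (by ext <;> simp [D, T, hσz])
    (fun g => by
      have hzg : ∀ v, r g (r z v) = r z (r g v) := fun v => by
        rw [← Module.End.mul_apply, ← Module.End.mul_apply, ← map_mul, ← map_mul,
          Subgroup.mem_center_iff.1 hz]
      ext <;> simp [D, T, hσ, hzg])
  have hπchar : ∀ g : G, Representation.character π (g : H) =
      ρ.character g + ρ.character (σ g) := fun g => by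
    rw [Representation.character, hπ]
    exact LinearMap.trace_prodMap' _ _
  have hind := character_induction (K := H) (fun f => 1 ≤ (fsIndicator H f).re)
    (fun ψ hψ => by simp [hH ψ hψ])
    (fun f₁ f₂ h₁ h₂ => by
      have : fsIndicator H (f₁ + f₂) = fsIndicator H f₁ + fsIndicator H f₂ := by
        simp only [fsIndicator, Pi.add_apply, Finset.sum_add_distrib, mul_add]
      rw [this, Complex.add_re]
      linarith) _ (π : Representation ℂ H (ρ × ρ)) rfl
  have hσsum : ∀ f : G → ℂ, ∑ g, f (σ g) = ∑ g, f g := fun f => Equiv.sum_comp σ.toEquiv f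
  have hσ₁ : ∑ g : G, ρ.character (σ (g * g)) = ∑ g : G, ρ.character (g * g) := by
    simp only [map_mul]
    exact hσsum fun g => ρ.character (g * g)
  have hσ₂ : ∑ g : G, ρ.character (σ (z * (g * σ g))) =
      ∑ g : G, ρ.character (z * (g * σ g)) := by
    rw [← hσsum fun g => ρ.character (z * (g * σ g))]
    simp only [map_mul, hσz]
  rw [hext] at hind
  simp only [hπchar, Finset.sum_add_distrib, hσ₁, hσ₂, hcoset ρ hρ, hsum, hneg] at hind
  ring_nf at hind
  norm_num at hind

end
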